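/- Let A be a Banach algebra over ℝ and let P : A satisfy P * P = -1. Then for every t : ℝ, the exponential satisfies exp (t • P) = Real.cos t • (1 : A) + Real.sin t • P (the rotor exponential behaves like the complex exponential e^{ti}). -/

import Mathlib

theorem exp_smul_of_sq_eq_neg_one
    {A : Type*} [NormedRing A] [NormedAlgebra ℝ A] [CompleteSpace A]
    (P : A) (hP : P * P = -1) (t : ℝ) :
    NormedSpace.exp (t • P) = Real.cos t • (1 : A) + Real.sin t • P := by
  let φ := Complex.liftAux P hP
  have hφ : Continuous φ := φ.toLinearMap.continuous_of_finiteDimensional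
  let : Algebra ℚ A := Algebra.compHom A (algebraMap ℚ ℝ)
  have h := NormedSpace.map_exp φ hφ (t * Complex.I)
  rw [← Complex.exp_eq_exp_ℂ] at h
  simpa [φ, Complex.liftAux_apply, Complex.exp_re, Complex.exp_im,
    Algebra.algebraMap_eq_smul_one] using h.symm
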